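/- arXiv:math/9809102 — 2 statements merged into one kernel-verified Lean document; each statement's English description precedes it below -/
import Mathlib

section
/- Let T, S be partial isometries on a complex Hilbert space H with S = S T* S. Then T T* S = S and S T* T = S. -/
open ContinuousLinearMap

section PartialIsometry

variable {H : Type*} [NormedAddCommGroup H] [InnerProductSpace ℂ H] [CompleteSpace H]

theorem adjoint_mul_self_mul_adjoint {W : H →L[ℂ] H} (hW : W * adjoint W * W = W) :
    adjoint W * W * adjoint W = adjoint W := by
  simpa only [← star_eq_adjoint, star_mul, star_star, mul_assoc] using congrArg star hW

/-- For a partial isometry `W`, Pythagoras for the range projection `W W*`. -/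
theorem norm_sub_range_projection_sq {W : H →L[ℂ] H} (hW : W * adjoint W * W = W) (y : H) :
    ‖y - W (adjoint W y)‖ ^ 2 = ‖y‖ ^ 2 - ‖adjoint W y‖ ^ 2 := by
  have key : adjoint W (W (adjoint W y)) = adjoint W y :=
    DFunLike.congr_fun (adjoint_mul_self_mul_adjoint hW) y
  have cross : RCLike.re (inner ℂ y (W (adjoint W y))) = ‖adjoint W y‖ ^ 2 := by
    rw [← adjoint_inner_left, inner_self_eq_norm_sq]
  have range : ‖W (adjoint W y)‖ ^ 2 = ‖adjoint W y‖ ^ 2 := by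
    rw [← inner_self_eq_norm_sq (𝕜 := ℂ), ← adjoint_inner_left, key, inner_self_eq_norm_sq]
  rw [norm_sub_sq (𝕜 := ℂ), cross, range]
  ring

theorem norm_adjoint_apply_le_of_partial_isometry {W : H →L[ℂ] H}
    (hW : W * adjoint W * W = W) (y : H) : ‖adjoint W y‖ ≤ ‖y‖ := by
  have h := norm_sub_range_projection_sq hW y
  refine le_of_sq_le_sq ?_ (norm_nonneg y)
  nlinarith [sq_nonneg ‖y - W (adjoint W y)‖]

theorem range_projection_mul_eq {T S : H →L[ℂ] H}
    (hT : T * adjoint T * T = T) (hS : S * adjoint S * S = S)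
    (hTS : S = S * adjoint T * S) : T * adjoint T * S = S := by
  ext x
  have contraction : ‖S (adjoint T (S x))‖ ≤ ‖adjoint T (S x)‖ := by
    have hS' : adjoint S * adjoint (adjoint S) * adjoint S = adjoint S := by
      rw [adjoint_adjoint]
      exact adjoint_mul_self_mul_adjoint hS
    simpa only [adjoint_adjoint] using
      norm_adjoint_apply_le_of_partial_isometry hS' (adjoint T (S x))
  have fixed : S (adjoint T (S x)) = S x := (DFunLike.congr_fun hTS x).symm
  rw [fixed] at contraction
  have pythagoras := norm_sub_range_projection_sq hT (S x)
  have zero : ‖S x - T (adjoint T (S x))‖ ^ 2 ≤ 0 := by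
    nlinarith [norm_nonneg (S x)]
  have vanish := pow_eq_zero_iff two_ne_zero |>.mp (le_antisymm zero (sq_nonneg _))
  exact (sub_eq_zero.mp (norm_eq_zero.mp vanish)).symm

end PartialIsometry

theorem stmt_3 {H : Type*} [NormedAddCommGroup H] [InnerProductSpace ℂ H]
    [CompleteSpace H] (T S : H →L[ℂ] H)
    (hT : T * adjoint T * T = T) (hS : S * adjoint S * S = S)
    (hTS : S = S * adjoint T * S) :
    T * adjoint T * S = S ∧ S * adjoint T * T = S := by
  refine ⟨range_projection_mul_eq hT hS hTS, ?_⟩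
  have h : adjoint T * adjoint (adjoint T) * adjoint S = adjoint S := by
    refine range_projection_mul_eq ?_ ?_ ?_
    · simpa only [adjoint_adjoint] using adjoint_mul_self_mul_adjoint hT
    · simpa only [adjoint_adjoint] using adjoint_mul_self_mul_adjoint hS
    · simpa only [← star_eq_adjoint, star_mul, star_star, mul_assoc] using congrArg star hTS
  simpa only [← star_eq_adjoint, star_mul, star_star, mul_assoc] using congrArg star h
end

section
/- Let C be a bounded operator on a complex Hilbert space H such that for every nonzero z ∈ H, either ⟨z, Cz⟩ = 0 or ⟨Cz, Cz⟩ = ⟨z, Cz⟩. If H has dimension at least 2 (so H \ {0} is connected), then either ⟨z, Cz⟩ = 0 for all z, or C* C = C. -/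
open scoped InnerProductSpace

open ContinuousLinearMap

/-- Along a real line, the quadratic form of an operator is a polynomial in the parameter. -/
lemma exists_polynomial_eval_eq_inner_apply_add_smul {H : Type*} [NormedAddCommGroup H]
    [InnerProductSpace ℂ H] (A : H →L[ℂ] H) (x y : H) :
    ∃ p : Polynomial ℂ, ∀ t : ℝ,
      p.eval (t : ℂ) = ⟪x + (t : ℂ) • y, A (x + (t : ℂ) • y)⟫_ℂ := by
  refine ⟨Polynomial.C ⟪x, A x⟫_ℂ + Polynomial.C (⟪x, A y⟫_ℂ + ⟪y, A x⟫_ℂ) * Polynomial.X +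
    Polynomial.C ⟪y, A y⟫_ℂ * Polynomial.X ^ 2, fun t => ?_⟩
  simp only [Polynomial.eval_add, Polynomial.eval_mul, Polynomial.eval_C, Polynomial.eval_X,
    Polynomial.eval_pow, map_add, map_smul, inner_add_left, inner_add_right, inner_smul_left,
    inner_smul_right, Complex.conj_ofReal]
  ring

/-- If at every vector one of two quadratic forms vanishes, then one of them vanishes
identically. -/
lemma forall_inner_apply_eq_zero_or {H : Type*} [NormedAddCommGroup H]
    [InnerProductSpace ℂ H] (A B : H →L[ℂ] H)
    (h : ∀ z : H, ⟪z, A z⟫_ℂ = 0 ∨ ⟪z, B z⟫_ℂ = 0) :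
    (∀ z : H, ⟪z, A z⟫_ℂ = 0) ∨ ∀ z : H, ⟪z, B z⟫_ℂ = 0 := by
  by_contra! hne
  obtain ⟨⟨x, hx⟩, ⟨y, hy⟩⟩ := hne
  obtain ⟨p, hp⟩ := exists_polynomial_eval_eq_inner_apply_add_smul A x (y - x)
  obtain ⟨q, hq⟩ := exists_polynomial_eval_eq_inner_apply_add_smul B x (y - x)
  have hpq : p * q = 0 := by
    refine Polynomial.eq_zero_of_infinite_isRoot _ <|
      (Set.infinite_range_of_injective Complex.ofReal_injective).mono ?_
    rintro _ ⟨t, rfl⟩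
    rw [Set.mem_ofPred_eq, Polynomial.IsRoot.def, Polynomial.eval_mul, hp, hq, mul_eq_zero]
    exact h _
  rcases mul_eq_zero.mp hpq with rfl | rfl
  · exact hx (by simpa using (hp 0).symm)
  · exact hy (by simpa using (hq 1).symm)

theorem stmt_16 {H : Type*} [NormedAddCommGroup H] [InnerProductSpace ℂ H]
    [CompleteSpace H] (hdim : 2 ≤ Module.rank ℂ H) (C : H →L[ℂ] H)
    (h : ∀ z : H, z ≠ 0 → ⟪z, C z⟫_ℂ = 0 ∨ ⟪C z, C z⟫_ℂ = ⟪z, C z⟫_ℂ) :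
    (∀ z : H, ⟪z, C z⟫_ℂ = 0) ∨ adjoint C * C = C := by
  have key (z : H) : ⟪z, (adjoint C * C - C) z⟫_ℂ = ⟪C z, C z⟫_ℂ - ⟪z, C z⟫_ℂ := by
    rw [sub_apply, inner_sub_right, mul_apply_eq_comp, adjoint_inner_right]
  refine (forall_inner_apply_eq_zero_or C (adjoint C * C - C) fun z => ?_).imp_right fun hz => ?_
  · rcases eq_or_ne z 0 with rfl | hz
    · simp
    · exact (h z hz).imp_right fun e => by rw [key, e, sub_self]
  · have h0 : ((adjoint C * C - C : H →L[ℂ] H) : H →ₗ[ℂ] H) = 0 :=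
      (inner_map_self_eq_zero _).mp fun z => inner_eq_zero_symm.mp (hz z)
    exact sub_eq_zero.mp (ContinuousLinearMap.coe_injective h0)
end
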